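/- arXiv:1703.02641 — 5 statements merged into one kernel-verified Lean document; each statement's English description precedes it below -/
import Mathlib

section
/- Fix real numbers D_1,…,D_n, error probabilities ε_1,…,ε_n with 0 ≤ ε_j < 1/2, a real target T, and an index i with D_i > 0. If ε'_i satisfies 0 ≤ ε'_i ≤ ε_i, then replacing ε_i by ε'_i (keeping all other ε_j fixed) does not increase the same classification probability: SCP(D, (ε_1,…,ε'_i,…,ε_n), T) ≤ SCP(D, (ε_1,…,ε_i,…,ε_n), T). -/
open Finset

/-- The same classification probability: the total probability weight of all error
subsets `S ⊆ {1,…,n}` whose `D`-sum exceeds the target `T`. -/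
noncomputable def SCP (n : ℕ) (D ε : Fin n → ℝ) (T : ℝ) : ℝ :=
  ∑ S ∈ (Finset.univ : Finset (Fin n)).powerset.filter (fun S => T < ∑ j ∈ S, D j),
    (∏ j ∈ S, ε j) * ∏ j ∈ Sᶜ, (1 - ε j)

/-- Conditioning on coordinate `i`: the error subsets pair up as `U` and `insert i U`
with `i ∉ U`. -/
theorem SCP_update_eq_sum_erase (n : ℕ) (D ε : Fin n → ℝ) (T : ℝ) (i : Fin n) (x : ℝ) :
    SCP n D (Function.update ε i x) T =
      ∑ U ∈ (univ.erase i).powerset,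
        ((∏ j ∈ U, ε j) * ∏ j ∈ univ.erase i \ U, (1 - ε j)) *
          ((if T < ∑ j ∈ U, D j then 1 - x else 0) +
            if T < D i + ∑ j ∈ U, D j then x else 0) := by
  unfold SCP
  rw [sum_filter]
  conv_lhs => rw [← insert_erase (mem_univ i)]
  rw [sum_powerset_insert (notMem_erase i univ), ← sum_add_distrib]
  refine sum_congr rfl fun U hU => ?_
  have hi : i ∉ U := fun h => notMem_erase i univ (mem_powerset.1 hU h)
  have hcompl : Uᶜ = insert i (univ.erase i \ U) := by
    ext j
    by_cases h : j = i <;> simp [h, hi]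
  have hcompl_insert : (insert i U)ᶜ = univ.erase i \ U := by
    ext j
    simp
  have hprod : ∏ j ∈ U, Function.update ε i x j = ∏ j ∈ U, ε j :=
    prod_congr rfl fun j hj =>
      Function.update_of_ne (ne_of_mem_of_not_mem hj hi) x ε
  have hprod_compl : ∏ j ∈ univ.erase i \ U, (1 - Function.update ε i x j) =
      ∏ j ∈ univ.erase i \ U, (1 - ε j) :=
    prod_congr rfl fun j hj => by
      rw [Function.update_of_ne (ne_of_mem_erase (mem_sdiff.1 hj).1)]
  rw [hcompl_insert, hcompl, prod_insert (by simp), prod_insert hi, sum_insert hi,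
    hprod, hprod_compl, Function.update_self]
  split_ifs <;> ring

theorem scp_decrease_of_pos_D (n : ℕ) (D ε : Fin n → ℝ) (T : ℝ) (i : Fin n) (ε' : ℝ)
    (hε : ∀ j, 0 ≤ ε j ∧ ε j < 1 / 2) (hD : 0 < D i)
    (hε'0 : 0 ≤ ε') (hε'le : ε' ≤ ε i) :
    SCP n D (Function.update ε i ε') T ≤ SCP n D ε T := by
  conv_rhs => rw [← Function.update_eq_self i ε]
  rw [SCP_update_eq_sum_erase, SCP_update_eq_sum_erase]
  refine sum_le_sum fun U _ => mul_le_mul_of_nonneg_left ?_ ?_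
  · split_ifs <;> linarith
  · exact mul_nonneg (prod_nonneg fun j _ => (hε j).1)
      (prod_nonneg fun j _ => by linarith [(hε j).2])
end

section
/- Fix real numbers D_1,…,D_n, error probabilities ε_1,…,ε_n with 0 ≤ ε_j < 1/2, a real target T, and an index i with D_i ≤ 0. If ε'_i satisfies 0 ≤ ε'_i ≤ ε_i, then replacing ε_i by ε'_i (keeping all other ε_j fixed) does not decrease the same classification probability: SCP(D, (ε_1,…,ε_i,…,ε_n), T) ≤ SCP(D, (ε_1,…,ε'_i,…,ε_n), T). -/
open Finset

/-- Conditioning the same classification probability on whether `i` errs. -/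
lemma SCP_eq_sum_powerset_erase (n : ℕ) (D ε : Fin n → ℝ) (T : ℝ) (i : Fin n) :
    SCP n D ε T = ∑ S ∈ (Finset.univ.erase i).powerset,
      ((∏ j ∈ S, ε j) * ∏ j ∈ (insert i S)ᶜ, (1 - ε j)) *
        ((1 - ε i) * (if T < ∑ j ∈ S, D j then 1 else 0) +
          ε i * (if T < D i + ∑ j ∈ S, D j then 1 else 0)) := by
  unfold SCP
  rw [Finset.sum_filter]
  conv_lhs => rw [← Finset.insert_erase (Finset.mem_univ i)]
  rw [Finset.sum_powerset_insert (Finset.notMem_erase i _), ← Finset.sum_add_distrib]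
  refine Finset.sum_congr rfl fun S hS => ?_
  have hi : i ∉ S := fun h => Finset.notMem_erase i _ (Finset.mem_powerset.mp hS h)
  have hc : Sᶜ = insert i (insert i S)ᶜ := by
    ext j
    by_cases hj : j = i <;> simp [hj, hi]
  rw [Finset.sum_insert hi, Finset.prod_insert hi, hc, Finset.prod_insert (by simp)]
  split_ifs <;> ring

theorem scp_increase_of_nonpos_D (n : ℕ) (D ε : Fin n → ℝ) (T : ℝ) (i : Fin n) (ε' : ℝ)
    (hε : ∀ j, 0 ≤ ε j ∧ ε j < 1 / 2) (hD : D i ≤ 0)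
    (hε'0 : 0 ≤ ε') (hε'le : ε' ≤ ε i) :
    SCP n D ε T ≤ SCP n D (Function.update ε i ε') T := by
  rw [SCP_eq_sum_powerset_erase n D ε T i,
    SCP_eq_sum_powerset_erase n D (Function.update ε i ε') T i]
  refine Finset.sum_le_sum fun S hS => ?_
  have hi : i ∉ S := fun h => Finset.notMem_erase i _ (Finset.mem_powerset.mp hS h)
  have hprod : ∏ j ∈ S, Function.update ε i ε' j = ∏ j ∈ S, ε j :=
    Finset.prod_congr rfl fun j hj =>
      Function.update_of_ne (ne_of_mem_of_not_mem hj hi) _ _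
  have hprod_compl : ∏ j ∈ (insert i S)ᶜ, (1 - Function.update ε i ε' j) =
      ∏ j ∈ (insert i S)ᶜ, (1 - ε j) :=
    Finset.prod_congr rfl fun j hj => by
      rw [Function.update_of_ne]
      rintro rfl
      simp at hj
  rw [hprod, hprod_compl, Function.update_self]
  refine mul_le_mul_of_nonneg_left ?_ (mul_nonneg (Finset.prod_nonneg fun j _ => (hε j).1)
    (Finset.prod_nonneg fun j _ => by linarith [(hε j).2]))
  split_ifs <;> linarith
end

section
/- Let n ≥ 1, let k ≥ 2, let ε_1,…,ε_n ∈ [0,1/2), let T be a real number, let b : {1,…,n} → {1,…,k} be a bucket assignment, let D_min be a real number and D_I > 0, and let the bucket midpoints be m_i = D_min + (i−1)·D_I/(k−1) for 1 ≤ i ≤ k. Define the approximate same classification probability SCP_app = Σ_{S ⊆ {1,…,n}, Σ_{j∈S} m_{b(j)} > T} (Π_{j∈S} ε_j)·(Π_{j∉S} (1−ε_j)), and the bivariate polynomial G(y,z) = Π_{j=1}^n ((1−ε_j) + ε_j·y·z^{b(j)}). Then SCP_app = Σ_{ℓ=0}^{n} Σ_{m : m > T'(ℓ)} (coefficient of y^ℓ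 z^m in G), where T'(ℓ) = ((k−1)/D_I)·(T − ℓ·(D_min − D_I/(k−1))). -/
open Finset MvPolynomial

/-- The generating function `∏ j, ((1 - ε j) + ε j * y * z ^ b j)` expanded over subsets. -/
theorem prod_genfun_eq_sum_monomial {ι R : Type*} [Fintype ι] [DecidableEq ι] [CommRing R]
    (ε : ι → R) (b : ι → ℕ) :
    (∏ j : ι, (C (1 - ε j) + C (ε j) * X (0 : Fin 2) * X (1 : Fin 2) ^ b j) :
      MvPolynomial (Fin 2) R) =
    ∑ S : Finset ι, monomial (Finsupp.single 0 #S + Finsupp.single 1 (∑ j ∈ S, b j))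
      ((∏ j ∈ S, ε j) * ∏ j ∈ Sᶜ, (1 - ε j)) := by
  simp_rw [add_comm (C (1 - ε _))]
  rw [Finset.prod_add, Finset.powerset_univ]
  refine Finset.sum_congr rfl fun S _ => ?_
  rw [← Finset.compl_eq_univ_sdiff, Finset.prod_mul_distrib, Finset.prod_mul_distrib,
    Finset.prod_const, Finset.prod_pow_eq_pow_sum, ← map_prod, ← map_prod, monomial_eq,
    Finsupp.prod_add_index' (by simp) (by simp [pow_add]), Finsupp.prod_single_index (by simp),
    Finsupp.prod_single_index (by simp), C_mul]
  ring

theorem single_add_single_inj {a a' c c' : ℕ} :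
    (Finsupp.single (0 : Fin 2) a + Finsupp.single 1 c =
      Finsupp.single 0 a' + Finsupp.single 1 c') ↔ a = a' ∧ c = c' := by
  refine ⟨fun h => ⟨?_, ?_⟩, by rintro ⟨rfl, rfl⟩; rfl⟩
  · simpa using DFunLike.congr_fun h 0
  · simpa using DFunLike.congr_fun h 1

/-- A set of bucket midpoints sums to more than `T` exactly when the sum of the bucket indices
exceeds the rescaled threshold. -/
theorem lt_sum_midpoints_iff {ι : Type*} (S : Finset ι) (b : ι → ℕ) {T Dmin DI κ : ℝ}
    (hDI : 0 < DI) (hκ : 0 < κ) :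
    T < ∑ j ∈ S, (Dmin + ((b j : ℝ) - 1) * DI / κ) ↔
      κ / DI * (T - (#S : ℝ) * (Dmin - DI / κ)) < ((∑ j ∈ S, b j : ℕ) : ℝ) := by
  have hsum : ∑ j ∈ S, (Dmin + ((b j : ℝ) - 1) * DI / κ) =
      (#S : ℝ) * (Dmin - DI / κ) + ((∑ j ∈ S, b j : ℕ) : ℝ) * (DI / κ) := by
    rw [Nat.cast_sum, Finset.sum_mul, ← nsmul_eq_mul, ← Finset.sum_const,
      ← Finset.sum_add_distrib]
    exact Finset.sum_congr rfl fun j _ => by ring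
  rw [hsum, ← sub_lt_iff_lt_add', ← div_lt_iff₀ (div_pos hDI hκ), div_div_eq_mul_div,
    mul_comm, mul_div_right_comm]

theorem scp_app_eq_genfun_coeffs (n k : ℕ) (hn : 1 ≤ n) (hk : 2 ≤ k)
    (ε : Fin n → ℝ) (hε : ∀ j, 0 ≤ ε j ∧ ε j < 1 / 2) (T Dmin DI : ℝ) (hDI : 0 < DI)
    (b : Fin n → ℕ) (hb : ∀ j, 1 ≤ b j ∧ b j ≤ k) :
    -- the approximate SCP, computed with each `D j` replaced by the bucket midpoint
    -- `m_{b j} = Dmin + (b j − 1)·DI/(k−1)`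
    (∑ S ∈ (Finset.univ : Finset (Fin n)).powerset.filter
        (fun S => T < ∑ j ∈ S, (Dmin + ((b j : ℝ) - 1) * DI / ((k : ℝ) - 1))),
      (∏ j ∈ S, ε j) * ∏ j ∈ Sᶜ, (1 - ε j)) =
    -- the sum, over `ℓ = 0,…,n` and over all `m` with `m > T'(ℓ)`, of the coefficient
    -- of `y^ℓ z^m` in `G(y,z) = ∏_j ((1−ε_j) + ε_j·y·z^{b j})`
    ∑ ℓ ∈ Finset.range (n + 1),
      ∑ m ∈ (Finset.range (n * k + 1)).filter
          (fun m : ℕ =>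
            ((k : ℝ) - 1) / DI * (T - (ℓ : ℝ) * (Dmin - DI / ((k : ℝ) - 1))) < (m : ℝ)),
        MvPolynomial.coeff (Finsupp.single (0 : Fin 2) ℓ + Finsupp.single (1 : Fin 2) m)
          (∏ j : Fin n,
            (MvPolynomial.C (1 - ε j) +
              MvPolynomial.C (ε j) * MvPolynomial.X (0 : Fin 2) *
                MvPolynomial.X (1 : Fin 2) ^ (b j))) := by
  have hκ : (0 : ℝ) < (k : ℝ) - 1 := by
    have : (2 : ℝ) ≤ k := by exact_mod_cast hk
    linarith
  simp_rw [prod_genfun_eq_sum_monomial, coeff_sum, coeff_monomial, single_add_single_inj]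
  simp_rw [Finset.sum_comm (t := (Finset.univ : Finset (Finset (Fin n))))]
  rw [Finset.powerset_univ, Finset.sum_filter]
  refine Finset.sum_congr rfl fun S _ => ?_
  have hcard : #S ∈ Finset.range (n + 1) := by
    simpa [Nat.lt_succ_iff] using Finset.card_le_univ S
  have hsum : ∑ j ∈ S, b j ∈ Finset.range (n * k + 1) := by
    rw [Finset.mem_range, Nat.lt_succ_iff]
    calc ∑ j ∈ S, b j ≤ #S * k := Finset.sum_le_card_nsmul S b k fun j _ => (hb j).2
      _ ≤ n * k := Nat.mul_le_mul_right k (Nat.lt_succ_iff.mp (Finset.mem_range.mp hcard))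
  simp_rw [lt_sum_midpoints_iff S b hDI hκ]
  rw [Finset.sum_eq_single_of_mem _ hcard fun l _ hl =>
    Finset.sum_eq_zero fun m _ => if_neg fun h => hl h.1.symm]
  simp only [true_and]
  rw [Finset.sum_ite_eq]
  simp only [Finset.mem_filter, hsum, true_and]
end

section
/- Let D_1,…,D_n and Q_1,…,Q_n be real numbers, let T be a real number, and suppose that for every i, D_i > T if and only if Q_i > T. Let ε ∈ [0,1/2) and let SCP(D) = Σ_{S ⊆ {1,…,n}, Σ_{j∈S} D_j > T} ε^{|S|}(1−ε)^{n−|S|} and SCP(Q) defined analogously with Q in place of D. Then |SCP(D) − SCP(Q)| ≤ Σ_{S ⊆ {1,…,n}, |S| ≥ 2} ε^{|S|}(1−ε)^{n−|S|} = 1 − (1−ε)^n − n·ε·(1−ε)^{n−1}. -/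
open Finset

/-- The same classification probability with identical per-feature error probability `ε`. -/
noncomputable def SCPe (n : ℕ) (D : Fin n → ℝ) (ε T : ℝ) : ℝ :=
  ∑ S ∈ (Finset.univ : Finset (Fin n)).powerset.filter (fun S => T < ∑ j ∈ S, D j),
    ε ^ S.card * (1 - ε) ^ (n - S.card)

/-- The total weight of the subsets of size at least two under the binomial weights. -/
lemma sum_filter_two_le_card_pow_mul (n : ℕ) (ε : ℝ) :
    ∑ S ∈ (Finset.univ : Finset (Fin n)).powerset.filter (fun S => 2 ≤ S.card),
        ε ^ S.card * (1 - ε) ^ (n - S.card) =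
      1 - (1 - ε) ^ n - (n : ℝ) * ε * (1 - ε) ^ (n - 1) := by
  have hall : ∑ k ∈ range (n + 1), n.choose k • (ε ^ k * (1 - ε) ^ (n - k)) = 1 := by
    have hpow := add_pow ε (1 - ε) n
    rw [add_sub_cancel, one_pow] at hpow
    refine Eq.trans (sum_congr rfl fun k _ => ?_) hpow.symm
    rw [nsmul_eq_mul, mul_comm]
  have hcard := sum_powerset_apply_card
    (fun k => if 2 ≤ k then ε ^ k * (1 - ε) ^ (n - k) else 0) (x := (univ : Finset (Fin n)))
  rw [sum_filter, hcard, card_univ, Fintype.card_fin]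
  rcases n with _ | n
  · simp
  · rw [sum_range_succ', sum_range_succ'] at hall ⊢
    simp at hall ⊢
    linarith

theorem scp_approx_error_improvement1 (n : ℕ) (D Q : Fin n → ℝ) (T ε : ℝ)
    (hε0 : 0 ≤ ε) (hε : ε < 1 / 2)
    (h : ∀ i, T < D i ↔ T < Q i) :
    |SCPe n D ε T - SCPe n Q ε T| ≤
      ∑ S ∈ (Finset.univ : Finset (Fin n)).powerset.filter (fun S => 2 ≤ S.card),
        ε ^ S.card * (1 - ε) ^ (n - S.card) ∧
    ∑ S ∈ (Finset.univ : Finset (Fin n)).powerset.filter (fun S => 2 ≤ S.card),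
        ε ^ S.card * (1 - ε) ^ (n - S.card) =
      1 - (1 - ε) ^ n - (n : ℝ) * ε * (1 - ε) ^ (n - 1) := by
  refine ⟨?_, sum_filter_two_le_card_pow_mul n ε⟩
  unfold SCPe
  rw [sum_filter, sum_filter, sum_filter, ← sum_sub_distrib]
  refine (abs_sum_le_sum_abs _ _).trans (sum_le_sum fun S _ => ?_)
  have hw : 0 ≤ ε ^ S.card * (1 - ε) ^ (n - S.card) :=
    mul_nonneg (pow_nonneg hε0 _) (pow_nonneg (by linarith) _)
  by_cases hS : 2 ≤ S.card
  · rw [if_pos hS]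
    split_ifs <;> simp [abs_of_nonneg hw, hw]
  · have hiff : T < ∑ j ∈ S, D j ↔ T < ∑ j ∈ S, Q j := by
      obtain h0 | h1 : S.card = 0 ∨ S.card = 1 := by omega
      · simp [card_eq_zero.mp h0]
      · obtain ⟨i, rfl⟩ := card_eq_one.mp h1
        simpa using h i
    simp [hiff, hS]
end

section
/- Let D_1,…,D_n and Q_1,…,Q_n be real numbers, let T be a real number, let r ≥ 0 be an integer, and suppose that for every subset S ⊆ {1,…,n} with |S| ≤ r, we have Σ_{j∈S} D_j > T if and only if Σ_{j∈S} Q_j > T. Let ε ∈ [0,1/2) and let SCP(D) = Σ_{S ⊆ {1,…,n}, Σ_{j∈S} D_j > T} ε^{|S|}(1−ε)^{n−|S|} and SCP(Q) defined analogously with Q in place of D. Then |SCP(D) − SCP(Q)| ≤ Σ_{ℓ=r+1}^{n} C(n,ℓ)·ε^{ℓ}·(1−ε)^{n−ℓ}. -/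
open Finset

theorem scp_approx_error_hybrid (n r : ℕ) (D Q : Fin n → ℝ) (T ε : ℝ)
    (hε0 : 0 ≤ ε) (hε : ε < 1 / 2)
    (h : ∀ S : Finset (Fin n), S.card ≤ r → (T < ∑ j ∈ S, D j ↔ T < ∑ j ∈ S, Q j)) :
    |SCPe n D ε T - SCPe n Q ε T| ≤
      ∑ ℓ ∈ Finset.Icc (r + 1) n, (n.choose ℓ : ℝ) * ε ^ ℓ * (1 - ε) ^ (n - ℓ) := by
  have key : ∑ ℓ ∈ Finset.Icc (r + 1) n, (n.choose ℓ : ℝ) * ε ^ ℓ * (1 - ε) ^ (n - ℓ) =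
      ∑ S ∈ (Finset.univ : Finset (Fin n)).powerset,
        if r < S.card then ε ^ S.card * (1 - ε) ^ (n - S.card) else 0 := by
    rw [Finset.sum_powerset_apply_card
      (fun m => if r < m then ε ^ m * (1 - ε) ^ (n - m) else (0 : ℝ))]
    simp only [Finset.card_univ, Fintype.card_fin, nsmul_eq_mul, mul_ite, mul_zero]
    rw [← Finset.sum_filter]
    refine Finset.sum_congr ?_ fun ℓ _ => mul_assoc _ _ _
    ext ℓ
    simp only [Finset.mem_Icc, Finset.mem_filter, Finset.mem_range]
    omega
  rw [key, SCPe, SCPe, Finset.sum_filter, Finset.sum_filter, ← Finset.sum_sub_distrib]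
  refine (Finset.abs_sum_le_sum_abs _ _).trans (Finset.sum_le_sum fun S _ => ?_)
  have hw : 0 ≤ ε ^ S.card * (1 - ε) ^ (n - S.card) :=
    mul_nonneg (pow_nonneg hε0 _) (pow_nonneg (by linarith) _)
  by_cases hS : r < S.card
  · rw [if_pos hS]
    split_ifs <;> simp [abs_of_nonneg hw, hw]
  · simp [hS, h S (not_lt.mp hS)]
end
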